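/- Λ(E_{φ,M,L}, χ, 1) = (φ(m)/(2·τ(φ⁻¹)))·χ(f·D)·(∏_{l ∣ T₁}(1 − χ(l)φ(l)/l))·(∏_{q ∣ T₂}(1 − χ(q)φ⁻¹(q)))·B₁(χ⁻¹φ⁻¹)·B₁(χφ⁻¹). -/

import Mathlib

open scoped BigOperators Real

/-- The Gauss sum `τ(ψ) = Σ_{a=0}^{c−1} ψ(a)·e^{2πia/c}` of a Dirichlet character mod `c`. -/
noncomputable def gaussSum' (c : ℕ) (ψ : DirichletCharacter ℂ c) : ℂ :=
  ∑ a ∈ Finset.range c, ψ ((a : ℕ) : ZMod c) * Complex.exp (2 * (π : ℂ) * Complex.I * a / c)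

/-- The first generalized Bernoulli number `B₁(ψ) = (1/c)·Σ_{a=0}^{c−1} ψ(a)·a`. -/
noncomputable def B1 (c : ℕ) (ψ : DirichletCharacter ℂ c) : ℂ :=
  (1 / (c : ℂ)) * ∑ a ∈ Finset.range c, ψ ((a : ℕ) : ZMod c) * (a : ℂ)

/-- The product character `χ·φ` modulo `f·m` of Dirichlet characters `χ` mod `m` and
`φ` mod `f`. -/
noncomputable def prodChar (m f : ℕ) (χ : DirichletCharacter ℂ m)
    (φ : DirichletCharacter ℂ f) : DirichletCharacter ℂ (f * m) :=
  (DirichletCharacter.changeLevel (dvd_mul_left m f) χ) *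
    (DirichletCharacter.changeLevel (dvd_mul_right f m) φ)

/-- The value at `s = 1` of the analytic continuation of the `χ`-twisted `L`-function of
`E_{φ,M,L}`:
`Λ(E_{φ,M,L}, χ, 1) = (τ(χ⁻¹)/(2πi))·χ(D)·∏_{l∣T₁}(1 − χφ(l)/l)·∏_{q∣T₂}(1 − χφ⁻¹(q))
·L(χφ, 1)·L(χφ⁻¹, 0)`. -/
noncomputable def LambdaVal (f m : ℕ) [NeZero f] [NeZero m] (φ : DirichletCharacter ℂ f)
    (χ : DirichletCharacter ℂ m) (T₁ T₂ D : ℕ) : ℂ :=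
  (gaussSum' m χ⁻¹ / (2 * (π : ℂ) * Complex.I)) * χ ((D : ℕ) : ZMod m) *
    (∏ l ∈ T₁.primeFactors,
      (1 - χ ((l : ℕ) : ZMod m) * φ ((l : ℕ) : ZMod f) / (l : ℂ))) *
    (∏ q ∈ T₂.primeFactors,
      (1 - χ ((q : ℕ) : ZMod m) * φ⁻¹ ((q : ℕ) : ZMod f))) *
    (prodChar m f χ φ).LFunction 1 * (prodChar m f χ φ⁻¹).LFunction 0

open Filter Topology HurwitzZeta Set in
lemma aux_real_mvt {a s : ℝ} (ha : 0 < a) (ha1 : a < 1) (hs : 0 < s) (n : ℕ) :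
    s * (1 - a) * ((n + 1 : ℝ) ^ (-(s + 1))) ≤ (n + a : ℝ) ^ (-s) - (n + 1 : ℝ) ^ (-s) ∧
    (n + a : ℝ) ^ (-s) - (n + 1 : ℝ) ^ (-s) ≤ s * (1 - a) * ((n + a : ℝ) ^ (-(s + 1))) := by
  have hn : (0 : ℝ) ≤ n := n.cast_nonneg
  have hd : ∀ x ∈ Set.Icc (n + a : ℝ) (n + 1),
      HasDerivAt (fun x : ℝ => x ^ (-s)) (-s * x ^ (-s - 1)) x := fun x hx =>
    Real.hasDerivAt_rpow_const (Or.inl (by have := hx.1; linarith))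
  obtain ⟨c, hc, hc'⟩ := exists_hasDerivAt_eq_slope (fun x : ℝ => x ^ (-s))
    (fun x => -s * x ^ (-s - 1)) (a := n + a) (b := n + 1) (by linarith)
    (fun x hx => (hd x hx).continuousAt.continuousWithinAt)
    (fun x hx => hd x (Set.Ioo_subset_Icc_self hx))
  have h1a : (0 : ℝ) < 1 - a := by linarith
  have e : (n + a : ℝ) ^ (-s) - (n + 1 : ℝ) ^ (-s) = s * (1 - a) * c ^ (-(s + 1)) := by
    have : (n + 1 - (n + a) : ℝ) = 1 - a := by ring
    rw [this, eq_div_iff h1a.ne', show -s - 1 = -(s + 1) by ring] at hc'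
    linarith
  rw [e]
  have hsa : 0 ≤ s * (1 - a) := by positivity
  constructor
  · apply mul_le_mul_of_nonneg_left _ hsa
    exact Real.rpow_le_rpow_of_nonpos (by linarith [hc.1]) hc.2.le (by linarith)
  · apply mul_le_mul_of_nonneg_left _ hsa
    exact Real.rpow_le_rpow_of_nonpos (by linarith [hc.1]) hc.1.le (by linarith)

lemma aux_norm_bound {a : ℝ} (ha : 0 < a) (ha1 : a < 1) {s : ℂ} {r R : ℝ} (hr : 0 < r)
    (hs : r ≤ s.re) (hR : ‖s‖ ≤ R) (n : ℕ) :
    ‖((n + a : ℝ) : ℂ) ^ (-s) - ((n + 1 : ℝ) : ℂ) ^ (-s)‖ ≤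
      R * ((n + a : ℝ) ^ (-(s.re + 1))) := by
  have hn : (0 : ℝ) ≤ n := n.cast_nonneg
  have hd : ∀ x ∈ Set.Icc (n + a : ℝ) (n + 1),
      HasDerivAt (fun x : ℝ => (x : ℂ) ^ (-s)) (-s * (x : ℂ) ^ (-s - 1)) x := fun x hx => by
    have h0 : 0 < x := by have := hx.1; linarith
    have := (hasDerivAt_id (x : ℂ)).cpow_const (c := -s)
      (Or.inl (by simpa using h0))
    simpa using this.comp_ofReal
  have hb : ∀ x ∈ Set.Icc (n + a : ℝ) (n + 1), ‖-s * (x : ℂ) ^ (-s - 1)‖ ≤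
      R * ((n + a : ℝ) ^ (-(s.re + 1))) := fun x hx => by
    have h0 : 0 < x := by have := hx.1; linarith
    rw [norm_mul, norm_neg, Complex.norm_cpow_eq_rpow_re_of_pos h0]
    have : (-s - 1).re = -(s.re + 1) := by simp; ring
    rw [this]
    apply mul_le_mul hR _ (by positivity) (le_trans (norm_nonneg _) hR)
    exact Real.rpow_le_rpow_of_nonpos (by linarith) hx.1 (by linarith)
  have := Convex.norm_image_sub_le_of_norm_hasDerivWithin_le
    (fun x hx => (hd x hx).hasDerivWithinAt) hb (convex_Icc _ _)
    (Set.right_mem_Icc.mpr (by linarith)) (Set.left_mem_Icc.mpr (by linarith))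
  refine this.trans ?_
  have hR0 : 0 ≤ R := le_trans (norm_nonneg _) hR
  have h2 : 0 ≤ R * ((n + a : ℝ) ^ (-(s.re + 1))) := by positivity
  have h3 : ‖(n + a - (n + 1) : ℝ)‖ ≤ 1 := by
    rw [show (n + a - (n + 1) : ℝ) = -(1 - a) by ring, norm_neg, Real.norm_of_nonneg (by linarith)]
    linarith
  calc _ ≤ R * ((n + a : ℝ) ^ (-(s.re + 1))) * 1 := mul_le_mul_of_nonneg_left h3 h2
    _ = _ := mul_one _

lemma aux_hasSum {a : ℝ} (ha : 0 < a) (ha1 : a ≤ 1) {s : ℂ} (hs : 1 < s.re) :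
    HasSum (fun n : ℕ => ((n + a : ℝ) : ℂ) ^ (-s)) (HurwitzZeta.hurwitzZeta (a : UnitAddCircle) s) := by
  convert! HurwitzZeta.hasSum_hurwitzZeta_of_one_lt_re ⟨ha.le, ha1⟩ hs using 2 with n
  rw [Complex.cpow_neg]; simp

lemma aux_hasSum_real {a : ℝ} (ha : 0 < a) (ha1 : a ≤ 1) {s : ℝ} (hs : 1 < s) :
    HasSum (fun n : ℕ => (n + a : ℝ) ^ (-s))
      (HurwitzZeta.hurwitzZeta (a : UnitAddCircle) s).re := by
  convert! Complex.hasSum_re (aux_hasSum ha ha1 (s := s) (by simpa using hs)) using 2 with n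
  rw [← Complex.ofReal_neg, ← Complex.ofReal_cpow (by positivity), Complex.ofReal_re]

lemma aux_summable_of_pos {a : ℝ} (ha : 0 < a) (ha1 : a ≤ 1) {r : ℝ} (hr : 0 < r) :
    Summable (fun n : ℕ => (n + a : ℝ) ^ (-(r + 1))) :=
  (aux_hasSum_real ha ha1 (s := r + 1) (by linarith)).summable

open HurwitzZeta in
lemma aux_diff_hasSumC {a : ℝ} (ha : 0 < a) (ha1 : a < 1) {s : ℝ} (hs : 0 < s) :
    HasSum (fun n : ℕ => (((n + a : ℝ) ^ (-s) - (n + 1 : ℝ) ^ (-s) : ℝ) : ℂ))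
      (hurwitzZeta (a : UnitAddCircle) s - hurwitzZeta ((1 : ℝ) : UnitAddCircle) s) := by
  set r := min (s / 2) 1 with hr
  have hr0 : 0 < r := by positivity
  set R : ℝ := s + 10 with hR
  let U : Set ℂ := {z | r < z.re} ∩ Metric.ball 0 R
  let F : ℕ → ℂ → ℂ := fun n z => ((n + a : ℝ) : ℂ) ^ (-z) - ((n + 1 : ℝ) : ℂ) ^ (-z)
  have hUo : IsOpen U := (isOpen_lt continuous_const Complex.continuous_re).inter Metric.isOpen_ball
  have hUc : Convex ℝ U := (convex_halfSpace_re_gt r).inter (convex_ball _ _)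
  have hbound1 : ∀ n z, z ∈ U → ‖F n z‖ ≤ R * (n + a : ℝ) ^ (-(z.re + 1)) := fun n z hz =>
    aux_norm_bound ha ha1 hr0 hz.1.le (mem_ball_zero_iff.mp hz.2).le n
  -- the summable bound
  let u : ℕ → ℝ := fun n => if n = 0 then 2 * (R * (a ^ (-(R + 1)))) else
    R * ((n + a : ℝ) ^ (-(r + 1)))
  have hu : Summable u := by
    rw [← summable_nat_add_iff 1]
    have := ((summable_nat_add_iff 1).mpr (aux_summable_of_pos ha ha1.le hr0)).mul_left R
    simpa [u] using this
  have hR0 : 0 < R := by positivity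
  have hFu : ∀ n z, z ∈ U → ‖F n z‖ ≤ u n := fun n z hz => by
    refine (hbound1 n z hz).trans ?_
    by_cases h : n = 0
    · subst h
      simp only [u, if_true, Nat.cast_zero, zero_add]
      have h1 : a ^ (-(z.re + 1)) ≤ a ^ (-(R + 1)) := by
        apply Real.rpow_le_rpow_of_exponent_ge ha ha1.le
        have : z.re ≤ ‖z‖ := Complex.re_le_norm z
        have h2 : ‖z‖ < R := by simpa using hz.2
        linarith
      have h3 : 0 < a ^ (-(R + 1)) := by positivity
      nlinarith [mul_le_mul_of_nonneg_left h1 hR0.le, mul_pos hR0 h3]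
    · simp only [u, h, if_false]
      apply mul_le_mul_of_nonneg_left _ hR0.le
      have h1 : (1 : ℝ) ≤ n := by exact_mod_cast Nat.one_le_iff_ne_zero.mpr h
      apply Real.rpow_le_rpow_of_exponent_le (by linarith)
      have : r < z.re := hz.1
      linarith
  have hFd : ∀ n, DifferentiableOn ℂ (F n) U := fun n => by
    have h1 : ((n + a : ℝ) : ℂ) ≠ 0 := by
      rw [Complex.ofReal_ne_zero]; positivity
    have h2 : ((n + 1 : ℝ) : ℂ) ≠ 0 := by
      rw [Complex.ofReal_ne_zero]; positivity
    apply Differentiable.differentiableOn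
    apply Differentiable.sub
    · exact differentiable_neg.const_cpow (Or.inl h1)
    · exact differentiable_neg.const_cpow (Or.inl h2)
  have hG := Complex.differentiableOn_tsum_of_summable_norm hu hFd hUo hFu
  have hH : DifferentiableOn ℂ (fun z => hurwitzZeta (a : UnitAddCircle) z -
      hurwitzZeta ((1 : ℝ) : UnitAddCircle) z) U :=
    (differentiable_hurwitzZeta_sub_hurwitzZeta _ _).differentiableOn
  have h2U : (2 : ℂ) ∈ U := by
    constructor
    · have : r ≤ 1 := min_le_right _ _
      simp only [Set.mem_ofPred_eq, Complex.re_ofNat]; linarith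
    · simp [hR]; linarith
  have hsU : (s : ℂ) ∈ U := by
    constructor
    · have : r ≤ s / 2 := min_le_left _ _
      simp only [Set.mem_ofPred_eq, Complex.ofReal_re]; linarith
    · simp [hR, abs_of_pos hs]
  have hev : (fun z => ∑' n, F n z) =ᶠ[nhds (2 : ℂ)] (fun z => hurwitzZeta (a : UnitAddCircle) z -
      hurwitzZeta ((1 : ℝ) : UnitAddCircle) z) := by
    have : {z : ℂ | 1 < z.re} ∈ nhds (2 : ℂ) :=
      (isOpen_lt continuous_const Complex.continuous_re).mem_nhds (by simp)
    filter_upwards [this] with z hz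
    exact ((aux_hasSum ha ha1.le hz).sub (aux_hasSum one_pos le_rfl hz)).tsum_eq
  have heq := (hG.analyticOnNhd hUo).eqOn_of_preconnected_of_eventuallyEq
    (hH.analyticOnNhd hUo) hUc.isPreconnected h2U hev hsU
  have hsum : Summable (fun n => F n s) := Summable.of_norm_bounded hu (fun n => hFu n s hsU)
  have := hsum.hasSum
  simp only at heq
  rw [heq] at this
  convert! this using 2 with n
  simp only [F]
  rw [← Complex.ofReal_neg, ← Complex.ofReal_cpow (by positivity),
    ← Complex.ofReal_cpow (by positivity), ← Complex.ofReal_sub]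

open HurwitzZeta in
lemma aux_diff_hasSum {a : ℝ} (ha : 0 < a) (ha1 : a < 1) {s : ℝ} (hs : 0 < s) :
    HasSum (fun n : ℕ => (n + a : ℝ) ^ (-s) - (n + 1 : ℝ) ^ (-s))
      (hurwitzZeta (a : UnitAddCircle) s - hurwitzZeta ((1 : ℝ) : UnitAddCircle) s).re :=
  Complex.hasSum_re (aux_diff_hasSumC ha ha1 hs)

open HurwitzZeta in
lemma aux_diff_im {a : ℝ} (ha : 0 < a) (ha1 : a < 1) {s : ℝ} (hs : 0 < s) :
    (hurwitzZeta (a : UnitAddCircle) s - hurwitzZeta ((1 : ℝ) : UnitAddCircle) s).im = 0 := by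
  have := Complex.hasSum_im (aux_diff_hasSumC ha ha1 hs)
  simp only [Complex.ofReal_im] at this
  exact this.unique hasSum_zero

open HurwitzZeta Filter Topology in
lemma aux_residue (a : UnitAddCircle) (c : ℝ) :
    Tendsto (fun s : ℝ => s * c * (hurwitzZeta a ((s + 1 : ℝ) : ℂ)).re) (𝓝[>] 0) (𝓝 c) := by
  have h := hurwitzZeta_residue_one a
  have h1 : Tendsto (fun s : ℝ => ((s + 1 : ℝ) : ℂ)) (𝓝[>] 0) (𝓝[≠] 1) := by
    apply tendsto_nhdsWithin_of_tendsto_nhds_of_eventually_within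
    · have : Continuous (fun s : ℝ => ((s + 1 : ℝ) : ℂ)) := by fun_prop
      simpa using this.tendsto 0 |>.mono_left nhdsWithin_le_nhds
    · filter_upwards [self_mem_nhdsWithin] with s hs
      have : s ≠ 0 := ne_of_gt hs
      simpa using this
  have h2 := ((Complex.continuous_re.tendsto _).comp (h.comp h1)).const_mul c
  simp only [Complex.one_re, mul_one] at h2
  refine h2.congr fun s => ?_
  simp only [Function.comp]
  have : ((s + 1 : ℝ) : ℂ) - 1 = (s : ℂ) := by push_cast; ring
  rw [this, Complex.re_ofReal_mul]; ring

open HurwitzZeta Filter Topology in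
lemma aux_hurwitz_zero_re {a : ℝ} (ha : 0 < a) (ha1 : a < 1) :
    (hurwitzZeta (a : UnitAddCircle) 0 - hurwitzZeta ((1 : ℝ) : UnitAddCircle) 0).re = 1 - a := by
  have hc : Tendsto (fun s : ℝ => (hurwitzZeta (a : UnitAddCircle) s -
      hurwitzZeta ((1 : ℝ) : UnitAddCircle) s).re) (𝓝[>] 0)
      (𝓝 (hurwitzZeta (a : UnitAddCircle) 0 - hurwitzZeta ((1 : ℝ) : UnitAddCircle) 0).re) := by
    have h1 := (differentiable_hurwitzZeta_sub_hurwitzZeta (a : UnitAddCircle)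
      ((1 : ℝ) : UnitAddCircle)).continuous
    have : Continuous (fun s : ℝ => (hurwitzZeta (a : UnitAddCircle) s -
      hurwitzZeta ((1 : ℝ) : UnitAddCircle) s).re) :=
      Complex.continuous_re.comp (h1.comp Complex.continuous_ofReal)
    simpa using (this.tendsto 0).mono_left nhdsWithin_le_nhds
  refine tendsto_nhds_unique hc ?_
  refine tendsto_of_tendsto_of_tendsto_of_le_of_le'
    (aux_residue ((1 : ℝ) : UnitAddCircle) (1 - a)) (aux_residue (a : UnitAddCircle) (1 - a)) ?_ ?_
  · filter_upwards [self_mem_nhdsWithin] with s hs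
    have hs : 0 < s := hs
    have e := (aux_hasSum_real one_pos le_rfl (s := s + 1) (by linarith)).mul_left (s * (1 - a))
    exact hasSum_le (fun n => (aux_real_mvt ha ha1 hs n).1) e (aux_diff_hasSum ha ha1 hs)
  · filter_upwards [self_mem_nhdsWithin] with s hs
    have hs : 0 < s := hs
    have e := (aux_hasSum_real ha ha1.le (s := s + 1) (by linarith)).mul_left (s * (1 - a))
    exact hasSum_le (fun n => (aux_real_mvt ha ha1 hs n).2) (aux_diff_hasSum ha ha1 hs) e
open HurwitzZeta Filter Topology in
lemma aux_hurwitz_zero {a : ℝ} (ha : 0 < a) (ha1 : a < 1) :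
    hurwitzZeta (a : UnitAddCircle) 0 = 1 / 2 - a := by
  have hc : Tendsto (fun s : ℝ => (hurwitzZeta (a : UnitAddCircle) s -
      hurwitzZeta ((1 : ℝ) : UnitAddCircle) s).im) (𝓝[>] 0)
      (𝓝 (hurwitzZeta (a : UnitAddCircle) 0 - hurwitzZeta ((1 : ℝ) : UnitAddCircle) 0).im) := by
    have h1 := (differentiable_hurwitzZeta_sub_hurwitzZeta (a : UnitAddCircle)
      ((1 : ℝ) : UnitAddCircle)).continuous
    have : Continuous (fun s : ℝ => (hurwitzZeta (a : UnitAddCircle) s -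
      hurwitzZeta ((1 : ℝ) : UnitAddCircle) s).im) :=
      Complex.continuous_im.comp (h1.comp Complex.continuous_ofReal)
    simpa using (this.tendsto 0).mono_left nhdsWithin_le_nhds
  have hc0 : (hurwitzZeta (a : UnitAddCircle) 0 -
      hurwitzZeta ((1 : ℝ) : UnitAddCircle) 0).im = 0 := by
    refine tendsto_nhds_unique hc (tendsto_const_nhds.congr' ?_)
    filter_upwards [self_mem_nhdsWithin] with s hs
    exact (aux_diff_im ha ha1 hs).symm
  have h1 : hurwitzZeta ((1 : ℝ) : UnitAddCircle) 0 = -1 / 2 := by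
    have : ((1 : ℝ) : UnitAddCircle) = 0 := by simp
    rw [this, hurwitzZeta_zero, riemannZeta_zero]
  have h2 : hurwitzZeta (a : UnitAddCircle) 0 - hurwitzZeta ((1 : ℝ) : UnitAddCircle) 0
      = ((1 - a : ℝ) : ℂ) := by
    apply Complex.ext
    · rw [aux_hurwitz_zero_re ha ha1, Complex.ofReal_re]
    · rw [hc0, Complex.ofReal_im]
  rw [h1, sub_eq_iff_eq_add] at h2
  rw [h2]; push_cast; ring

lemma aux_range_sum (c : ℕ) [NeZero c] (g : ZMod c → ℂ) (h : ℕ → ℂ) :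
    ∑ a ∈ Finset.range c, g ((a : ℕ) : ZMod c) * h a = ∑ j : ZMod c, g j * h j.val := by
  refine Finset.sum_bij' (fun a _ => ((a : ℕ) : ZMod c)) (fun j _ => j.val) ?_ ?_ ?_ ?_ ?_
  · simp
  · intro j _; simpa using ZMod.val_lt j
  · intro a ha; exact ZMod.val_cast_of_lt (by simpa using ha)
  · intro j _; simp
  · intro a ha; rw [ZMod.val_cast_of_lt (by simpa using ha)]

lemma aux_gaussSum (c : ℕ) [NeZero c] (ψ : DirichletCharacter ℂ c) :
    gaussSum' c ψ = gaussSum ψ ZMod.stdAddChar := by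
  rw [gaussSum', aux_range_sum c ψ (fun a => Complex.exp (2 * (π : ℂ) * Complex.I * a / c)), gaussSum]
  refine Finset.sum_congr rfl fun j _ => ?_
  congr 1
  have := ZMod.stdAddChar_coe (N := c) (j.val : ℤ)
  simpa using this.symm

lemma aux_L_zero (c : ℕ) [NeZero c] (ψ : DirichletCharacter ℂ c) (hψ : ψ ≠ 1) :
    ψ.LFunction 0 = - B1 c ψ := by
  have hc : c ≠ 1 := fun h => hψ (DirichletCharacter.level_one' ψ h)
  have h0 : ψ 0 = 0 := ψ.map_zero' hc
  have hcC : (c : ℂ) ≠ 0 := NeZero.ne _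
  have hsum : ∑ j, ψ j = 0 := ψ.sum_eq_zero_of_ne_one hψ
  rw [DirichletCharacter.LFunction, ZMod.LFunction, B1, aux_range_sum c ψ (fun a => (a : ℂ))]
  have : ∀ j : ZMod c, ψ j * HurwitzZeta.hurwitzZeta (ZMod.toAddCircle j) 0 =
      ψ j * (1 / 2) - (1 / (c : ℂ)) * (ψ j * (j.val : ℂ)) := by
    intro j
    by_cases hj : j = 0
    · simp [hj, h0]
    · have hv : 0 < j.val := Nat.pos_of_ne_zero (by simpa using hj)
      have hcp : (0 : ℝ) < c := by exact_mod_cast NeZero.pos c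
      rw [ZMod.toAddCircle_apply, aux_hurwitz_zero (by positivity)
        (by rw [div_lt_one hcp]; exact_mod_cast ZMod.val_lt j)]
      push_cast
      ring
  simp only [this, neg_zero, Complex.cpow_zero, one_mul, Finset.sum_sub_distrib,
    ← Finset.sum_mul, ← Finset.mul_sum, hsum]
  ring

lemma aux_L_one (c : ℕ) [NeZero c] (θ : DirichletCharacter ℂ c) (hθ1 : θ ≠ 1)
    (hθ : θ.IsPrimitive) (ho : θ.Odd) :
    B1 c θ = Complex.I / π * gaussSum θ ZMod.stdAddChar * (θ⁻¹).LFunction 1 := by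
  have hc : c ≠ 1 := fun h => hθ1 (DirichletCharacter.level_one' θ h)
  have h0 : θ 0 = 0 := θ.map_zero' hc
  have h := ZMod.LFunction_one_sub (N := c) θ (s := 1)
    (fun n h => by
      have := congrArg Complex.re h
      simp at this
      have h2 : (0 : ℝ) ≤ n := n.cast_nonneg
      linarith) (Or.inl h0)
  have hL : (DirichletCharacter.LFunction θ 0) = _ := aux_L_zero c θ hθ1
  have e1 : ZMod.dft (θ : ZMod c → ℂ) = fun k => (-gaussSum θ ZMod.stdAddChar) * θ⁻¹ k := by
    ext k
    rw [hθ.fourierTransform_eq_inv_mul_gaussSum]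
    have : (θ⁻¹) (-k) = - θ⁻¹ k := by
      have ho' : (θ⁻¹).Odd := by
        have h : θ (-1) = -1 := ho
        change θ⁻¹ (-1) = -1
        rw [MulChar.inv_apply_eq_inv', h]; norm_num
      exact DirichletCharacter.Odd.eval_neg _ k ho'
    rw [this]; ring
  have e2 : (fun x => θ (-x)) = fun x => (-1 : ℂ) * θ x := by
    ext x; rw [ho.eval_neg]; ring
  have e3 : ∀ (r : ℂ) (Φ : ZMod c → ℂ), ZMod.LFunction (fun k => r * Φ k) 1 =
      r * ZMod.LFunction Φ 1 := by
    intro r Φ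
    simp only [ZMod.LFunction, Finset.mul_sum]
    refine Finset.sum_congr rfl fun j _ => by ring
  rw [e2, ZMod.dft_const_mul, e3, e1, e3] at h
  rw [sub_self] at h
  change DirichletCharacter.LFunction θ 0 = _ at h
  rw [hL] at h
  have x1 : Complex.exp (π * Complex.I * 1 / 2) = Complex.I := by
    rw [mul_one, show (π : ℂ) * Complex.I / 2 = π / 2 * Complex.I by ring,
      Complex.exp_pi_div_two_mul_I]
  have x2 : Complex.exp (-π * Complex.I * 1 / 2) = -Complex.I := by
    rw [mul_one, show -(π : ℂ) * Complex.I / 2 = -π / 2 * Complex.I by ring,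
      Complex.exp_neg_pi_div_two_mul_I]
  rw [x1, x2, Complex.cpow_zero, Complex.Gamma_one, Complex.cpow_neg_one] at h
  have hp : (π : ℂ) ≠ 0 := by exact_mod_cast Real.pi_ne_zero
  rw [neg_eq_iff_eq_neg] at h
  rw [h]
  unfold DirichletCharacter.LFunction
  field_simp
  ring

lemma aux_prodChar_apply (m f : ℕ) (χ : DirichletCharacter ℂ m) (φ : DirichletCharacter ℂ f)
    (a : ℤ) : prodChar m f χ φ a = χ a * φ a := by
  by_cases ha : IsCoprime a ((f * m : ℕ) : ℤ)
  · rw [prodChar, MulChar.mul_apply, DirichletCharacter.changeLevel_eq_cast_of_dvd' _ _ ha,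
      DirichletCharacter.changeLevel_eq_cast_of_dvd' _ _ ha]
  · rw [(DirichletCharacter.apply_eq_zero_iff _ a).mpr ha]
    rw [eq_comm, mul_eq_zero, DirichletCharacter.apply_eq_zero_iff,
      DirichletCharacter.apply_eq_zero_iff]
    by_contra! h
    apply ha
    push_cast
    exact h.2.mul_right h.1

lemma aux_prodChar_inv (m f : ℕ) (χ : DirichletCharacter ℂ m) (φ : DirichletCharacter ℂ f) :
    (prodChar m f χ φ)⁻¹ = prodChar m f χ⁻¹ φ⁻¹ := by
  simp [prodChar, map_inv, mul_comm]

lemma aux_prodChar_prim (m f : ℕ) [NeZero m] [NeZero f] (hfm : Nat.Coprime f m)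
    (χ : DirichletCharacter ℂ m) (φ : DirichletCharacter ℂ f) (hχ : χ.IsPrimitive)
    (hφ : φ.IsPrimitive) : (prodChar m f χ φ).IsPrimitive := by
  rw [DirichletCharacter.isPrimitive_def] at *
  set A := DirichletCharacter.changeLevel (dvd_mul_left m f) χ with hA
  set B := DirichletCharacter.changeLevel (dvd_mul_right f m) φ with hB
  have cA : A.conductor = m := by rw [hA, DirichletCharacter.conductor_changeLevel, hχ]
  have cB : B.conductor = f := by rw [hB, DirichletCharacter.conductor_changeLevel, hφ]
  have hP : prodChar m f χ φ = A * B := rfl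
  rw [hP]
  have h1 : m ∣ (A * B).conductor := by
    have := DirichletCharacter.conductor_mul_dvd_lcm_conductor (A * B) B⁻¹
    rw [mul_inv_cancel_right, DirichletCharacter.conductor_inv, cA, cB] at this
    exact hfm.symm.dvd_of_dvd_mul_right (this.trans (Nat.lcm_dvd_mul _ _))
  have h2 : f ∣ (A * B).conductor := by
    have := DirichletCharacter.conductor_mul_dvd_lcm_conductor (A * B) A⁻¹
    rw [mul_inv_cancel_comm, DirichletCharacter.conductor_inv, cA, cB] at this
    exact hfm.dvd_of_dvd_mul_right (this.trans (Nat.lcm_dvd_mul _ _))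
  exact Nat.dvd_antisymm (DirichletCharacter.conductor_dvd_level _)
    (hfm.mul_dvd_of_dvd_of_dvd h2 h1)

lemma aux_gaussSum_ne_zero (c : ℕ) [NeZero c] (ψ : DirichletCharacter ℂ c)
    (h : ψ.IsPrimitive) : gaussSum ψ ZMod.stdAddChar ≠ 0 := by
  intro h0
  have e : ZMod.dft (ψ : ZMod c → ℂ) = 0 := by
    ext k
    rw [h.fourierTransform_eq_inv_mul_gaussSum, h0, mul_zero, Pi.zero_apply]
  have e1 : (ψ : ZMod c → ℂ) = 0 := (LinearEquiv.map_eq_zero_iff _).mp e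
  have := congrFun e1 1
  simp at this

lemma aux_gaussSum_prod (m f : ℕ) [NeZero m] [NeZero f] (hfm : Nat.Coprime f m)
    (χ : DirichletCharacter ℂ m) (φ : DirichletCharacter ℂ f) (hχ : χ.IsPrimitive)
    (hφ : φ.IsPrimitive) :
    gaussSum (prodChar m f χ φ) ZMod.stdAddChar =
      χ f * φ m * gaussSum χ ZMod.stdAddChar * gaussSum φ ZMod.stdAddChar := by
  obtain ⟨u, v, huv⟩ := Nat.isCoprime_iff_coprime.mpr hfm
  have hu : (u : ZMod m) * (f : ZMod m) = 1 := by
    have := congrArg (Int.cast : ℤ → ZMod m) huv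
    simpa using this
  have hv : (v : ZMod f) * (m : ZMod f) = 1 := by
    have := congrArg (Int.cast : ℤ → ZMod f) huv
    simpa using this
  have hχu : χ⁻¹ (u : ZMod m) = χ f := by
    have : χ u * χ f = 1 := by rw [← map_mul, hu, map_one]
    rw [MulChar.inv_apply_eq_inv']; exact inv_eq_of_mul_eq_one_right this
  have hφv : φ⁻¹ (v : ZMod f) = φ m := by
    have : φ v * φ m = 1 := by rw [← map_mul, hv, map_one]
    rw [MulChar.inv_apply_eq_inv']; exact inv_eq_of_mul_eq_one_right this
  have key : gaussSum (prodChar m f χ φ) ZMod.stdAddChar =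
      gaussSum χ (ZMod.stdAddChar.mulShift (u : ZMod m)) *
      gaussSum φ (ZMod.stdAddChar.mulShift (v : ZMod f)) := by
    simp only [gaussSum]
    rw [mul_comm (∑ a, _), Finset.sum_mul_sum, ← Finset.sum_product']
    refine Fintype.sum_equiv (ZMod.chineseRemainder hfm).toEquiv _ _ fun z => ?_
    obtain ⟨a, rfl⟩ := ZMod.intCast_surjective z
    simp only [RingEquiv.toEquiv_eq_coe, EquivLike.coe_coe, map_intCast, Prod.fst_intCast,
      Prod.snd_intCast, AddChar.mulShift_apply]
    rw [aux_prodChar_apply, ← Int.cast_mul, ← Int.cast_mul, ZMod.stdAddChar_coe,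
      ZMod.stdAddChar_coe, ZMod.stdAddChar_coe]
    have hf0 : (f : ℂ) ≠ 0 := NeZero.ne _
    have hm0 : (m : ℂ) ≠ 0 := NeZero.ne _
    have huvC : (u : ℂ) * f + v * m = 1 := by exact_mod_cast congrArg (Int.cast : ℤ → ℂ) huv
    have : (2 * π * Complex.I * a / (f * m : ℕ) : ℂ) =
      2 * π * Complex.I * (v * a : ℤ) / f + 2 * π * Complex.I * (u * a : ℤ) / m := by
      push_cast
      field_simp
      linear_combination (-(a : ℂ)) * huvC
    rw [this, Complex.exp_add]
    ring
  rw [key, gaussSum_mulShift_of_isPrimitive _ hχ, gaussSum_mulShift_of_isPrimitive _ hφ, hχu, hφv]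
  ring

/-- The special value formula
`Λ(E_{φ,M,L}, χ, 1) = (φ(m)/(2τ(φ⁻¹)))·χ(fD)·∏_{l∣T₁}(1 − χφ(l)/l)
·∏_{q∣T₂}(1 − χφ⁻¹(q))·B₁(χ⁻¹φ⁻¹)·B₁(χφ⁻¹)`. -/
theorem LambdaVal_eq
    (f : ℕ) [NeZero f] (hf : 1 < f) (φ : DirichletCharacter ℂ f)
    (hφ : φ ≠ 1) (hφprim : φ.IsPrimitive)
    (N M L : ℕ) (hN : 0 < N) (hM : 0 < M) (hL : 0 < L)
    (hdvd : f ^ 2 * M * L ∣ N) (hcop : Nat.Coprime (f * M) L)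
    (T₁ T₂ D : ℕ)
    (hT₁ : T₁ = ∏ l ∈ M.primeFactors.filter (fun l => ¬ l ∣ f), l)
    (hT₂ : T₂ = ∏ q ∈ L.primeFactors, q)
    (hD : D = M * L / (T₁ * T₂))
    (m : ℕ) [NeZero m] (χ : DirichletCharacter ℂ m)
    (hχ : χ ≠ 1) (hχprim : χ.IsPrimitive) (hm : Nat.Coprime m N) :
    LambdaVal f m φ χ T₁ T₂ D =
      (φ ((m : ℕ) : ZMod f) / (2 * gaussSum' f φ⁻¹)) * χ ((f * D : ℕ) : ZMod m) *
        (∏ l ∈ T₁.primeFactors,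
          (1 - χ ((l : ℕ) : ZMod m) * φ ((l : ℕ) : ZMod f) / (l : ℂ))) *
        (∏ q ∈ T₂.primeFactors,
          (1 - χ ((q : ℕ) : ZMod m) * φ⁻¹ ((q : ℕ) : ZMod f))) *
        B1 (f * m) (prodChar m f χ⁻¹ φ⁻¹) * B1 (f * m) (prodChar m f χ φ⁻¹) := by
  have hfm : Nat.Coprime f m :=
    (Nat.Coprime.coprime_dvd_right
      (((dvd_pow_self f two_ne_zero).mul_right M).mul_right L |>.trans hdvd) hm).symm
  have hχi : (χ⁻¹).IsPrimitive := by
    rw [DirichletCharacter.isPrimitive_def, DirichletCharacter.conductor_inv]; exact hχprim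
  have hφi : (φ⁻¹).IsPrimitive := by
    rw [DirichletCharacter.isPrimitive_def, DirichletCharacter.conductor_inv]; exact hφprim
  have hfm1 : f * m ≠ 1 := by
    intro h
    have := Nat.eq_one_of_mul_eq_one_right h
    omega
  have hne : ∀ ψ : DirichletCharacter ℂ (f * m), ψ.IsPrimitive → ψ ≠ 1 := by
    intro ψ hp h
    rw [DirichletCharacter.eq_one_iff_conductor_eq_one] at h
    exact hfm1 (hp.symm.trans h)
  have p1 := aux_prodChar_prim m f hfm χ⁻¹ φ⁻¹ hχi hφi
  have p2 := aux_prodChar_prim m f hfm χ φ⁻¹ hχprim hφi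
  have hL0 := aux_L_zero (f * m) (prodChar m f χ φ⁻¹) (hne _ p2)
  have hval : ∀ (n : ℕ) (ψ : DirichletCharacter ℂ n), ψ⁻¹ (-1) = ψ (-1) := by
    intro n ψ
    rw [MulChar.inv_apply_eq_inv']
    rcases ψ.even_or_odd with h | h
    · have h : ψ (-1) = 1 := h
      rw [h]; norm_num
    · have h : ψ (-1) = -1 := h
      rw [h]; norm_num
  have hpar : prodChar m f χ⁻¹ φ⁻¹ (-1) = prodChar m f χ φ⁻¹ (-1) := by
    have e1 := aux_prodChar_apply m f χ⁻¹ φ⁻¹ (-1)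
    have e2 := aux_prodChar_apply m f χ φ⁻¹ (-1)
    push_cast at e1 e2
    rw [e1, e2, hval m χ]
  have hinv : (prodChar m f χ⁻¹ φ⁻¹)⁻¹ = prodChar m f χ φ := by
    rw [aux_prodChar_inv, inv_inv, inv_inv]
  unfold LambdaVal
  rw [hL0]
  rcases (prodChar m f χ⁻¹ φ⁻¹).even_or_odd with he | ho
  · have he2 : (prodChar m f χ φ⁻¹).Even := hpar.symm.trans he
    have hz : (prodChar m f χ φ⁻¹).LFunction 0 = 0 := by
      rw [DirichletCharacter.LFunction, ZMod.LFunction_apply_zero_of_even he2.to_fun,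
        DirichletCharacter.map_zero' _ hfm1]
      simp
    have hB : B1 (f * m) (prodChar m f χ φ⁻¹) = 0 := by
      rw [hz] at hL0
      exact neg_eq_zero.mp hL0.symm
    rw [hB]; simp
  · rw [aux_L_one (f * m) _ (hne _ p1) p1 ho, hinv, aux_gaussSum_prod m f hfm _ _ hχi hφi,
      aux_gaussSum, aux_gaussSum]
    have hg := aux_gaussSum_ne_zero f _ hφi
    have hχf : χ⁻¹ (f : ZMod m) * χ (f : ZMod m) = 1 := by
      rw [← MulChar.mul_apply, inv_mul_cancel, MulChar.one_apply]
      exact (ZMod.isUnit_iff_coprime f m).mpr hfm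
    have hφm : φ⁻¹ (m : ZMod f) * φ (m : ZMod f) = 1 := by
      rw [← MulChar.mul_apply, inv_mul_cancel, MulChar.one_apply]
      exact (ZMod.isUnit_iff_coprime m f).mpr hfm.symm
    have hp : (π : ℂ) ≠ 0 := by exact_mod_cast Real.pi_ne_zero
    have hI : (2 * (π : ℂ) * Complex.I)⁻¹ = -(Complex.I / (2 * π)) := by
      rw [mul_inv, Complex.inv_I]; field_simp
    rw [div_eq_mul_inv (gaussSum χ⁻¹ _), hI]
    push_cast
    rw [map_mul]
    generalize (∏ l ∈ T₁.primeFactors,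
      (1 - χ ((l : ℕ) : ZMod m) * φ ((l : ℕ) : ZMod f) / (l : ℂ))) = P₁
    generalize (∏ q ∈ T₂.primeFactors,
      (1 - χ ((q : ℕ) : ZMod m) * φ⁻¹ ((q : ℕ) : ZMod f))) = P₂
    generalize B1 (f * m) (prodChar m f χ φ⁻¹) = B
    generalize (prodChar m f χ φ).LFunction 1 = Λ
    have hgg : (2 * gaussSum φ⁻¹ ZMod.stdAddChar)⁻¹ * gaussSum φ⁻¹ ZMod.stdAddChar = 1 / 2 := by
      field_simp
    rw [div_eq_mul_inv (φ _)]
    generalize gaussSum χ⁻¹ ZMod.stdAddChar = G at *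
    generalize (2 * gaussSum φ⁻¹ ZMod.stdAddChar)⁻¹ = H at *
    generalize gaussSum φ⁻¹ ZMod.stdAddChar = K at *
    generalize χ⁻¹ (f : ZMod m) = a at *
    generalize χ (f : ZMod m) = b at *
    generalize φ⁻¹ (m : ZMod f) = c at *
    generalize φ (m : ZMod f) = d at *
    calc _ = (1 / 2) * 1 * 1 * (G * χ (D : ZMod m) * P₁ * P₂ * Λ * B * (Complex.I / π)) := by ring
      _ = _ := by rw [← hgg]; nth_rewrite 1 [← hχf]; nth_rewrite 1 [← hφm]; ring
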